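/- arXiv:1111.1613 — 2 statements merged into one kernel-verified Lean document; each statement's English description precedes it below -/
import Mathlib

section
/- Let n ≥ 2 and let F : ℝ^{n+1} → ℝ^{n+1} be a causal automorphism of (n+1)-dimensional Minkowski spacetime. Then there exist a real number a > 0, an orthochronous Lorentz matrix A of size (n+1)×(n+1), and a vector b ∈ ℝ^{n+1} such that F(x) = a·(A x) + b for all x ∈ ℝ^{n+1}. (Zeeman's theorem.) -/
open scoped BigOperators
open Matrix

noncomputable section

/-- Sign vector of the Minkowski metric: `+1` for the first `n` coordinates, `-1` for the last. -/
def eps (n : ℕ) (i : Fin (n + 1)) : ℝ := if i = Fin.last n then -1 else 1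

/-- The Minkowski bilinear form `η(u,v) = Σ_{i<n} u_i v_i − u_n v_n` on `ℝ^{n+1}`. -/
def eta (n : ℕ) (u v : Fin (n + 1) → ℝ) : ℝ := ∑ i, eps n i * u i * v i

/-- Partial derivative in the `i`-th coordinate direction. -/
def pd (n : ℕ) (f : (Fin (n + 1) → ℝ) → ℝ) (i : Fin (n + 1)) (x : Fin (n + 1) → ℝ) : ℝ :=
  fderiv ℝ f x (Pi.single i 1)

/-- The wave operator `□φ = Σ_{i=1}^n ∂²φ/∂x_i² − ∂²φ/∂x_{n+1}²`. -/
def waveOp (n : ℕ) (f : (Fin (n + 1) → ℝ) → ℝ) (x : Fin (n + 1) → ℝ) : ℝ :=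
  ∑ i, eps n i * pd n (pd n f i) i x

/-- The causal order on Minkowski space: `x ≤ y` iff `y − x` is causal and future-pointing. -/
def causalLe (n : ℕ) (x y : Fin (n + 1) → ℝ) : Prop :=
  eta n (y - x) (y - x) ≤ 0 ∧ x (Fin.last n) ≤ y (Fin.last n)

/-- A causal automorphism: a bijection preserving the causal order in both directions. -/
def IsCausalAuto (n : ℕ) (F : (Fin (n + 1) → ℝ) → (Fin (n + 1) → ℝ)) : Prop :=
  Function.Bijective F ∧ ∀ x y, causalLe n x y ↔ causalLe n (F x) (F y)

/-- The matrix `η = diag(1, …, 1, −1)`. -/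
def etaM (n : ℕ) : Matrix (Fin (n + 1)) (Fin (n + 1)) ℝ := Matrix.diagonal (eps n)

/-- A Lorentz matrix: `Aᵀ η A = η`. -/
def IsLorentz (n : ℕ) (A : Matrix (Fin (n + 1)) (Fin (n + 1)) ℝ) : Prop :=
  Aᵀ * etaM n * A = etaM n

/-- The `i`-th row of the Jacobian of `F` at `x`. -/
def jacRow (n : ℕ) (F : (Fin (n + 1) → ℝ) → (Fin (n + 1) → ℝ)) (i : Fin (n + 1))
    (x : Fin (n + 1) → ℝ) : Fin (n + 1) → ℝ :=
  fun j => pd n (fun z => F z i) j x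

section Bilinear

variable {n : ℕ}

theorem eta_add_left (u v w : Fin (n + 1) → ℝ) : eta n (u + v) w = eta n u w + eta n v w := by
  simp only [eta, ← Finset.sum_add_distrib, Pi.add_apply]
  exact Finset.sum_congr rfl fun i _ => by ring

theorem eta_smul_left (t : ℝ) (u v : Fin (n + 1) → ℝ) : eta n (t • u) v = t * eta n u v := by
  simp only [eta, Finset.mul_sum, Pi.smul_apply, smul_eq_mul]
  exact Finset.sum_congr rfl fun i _ => by ring

theorem eta_comm (u v : Fin (n + 1) → ℝ) : eta n u v = eta n v u := by
  simp only [eta]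
  exact Finset.sum_congr rfl fun i _ => by ring

theorem eta_add_right (u v w : Fin (n + 1) → ℝ) : eta n u (v + w) = eta n u v + eta n u w := by
  rw [eta_comm, eta_add_left, eta_comm v, eta_comm w]

theorem eta_smul_right (t : ℝ) (u v : Fin (n + 1) → ℝ) : eta n u (t • v) = t * eta n u v := by
  rw [eta_comm, eta_smul_left, eta_comm]

theorem eta_neg_left (u v : Fin (n + 1) → ℝ) : eta n (-u) v = -eta n u v := by
  simpa using eta_smul_left (-1) u v

theorem eta_neg_right (u v : Fin (n + 1) → ℝ) : eta n u (-v) = -eta n u v := by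
  simpa using eta_smul_right (-1) u v

theorem eta_sub_left (u v w : Fin (n + 1) → ℝ) : eta n (u - v) w = eta n u w - eta n v w := by
  rw [sub_eq_add_neg, eta_add_left, eta_neg_left, sub_eq_add_neg]

theorem eta_sub_right (u v w : Fin (n + 1) → ℝ) : eta n u (v - w) = eta n u v - eta n u w := by
  rw [sub_eq_add_neg, eta_add_right, eta_neg_right, sub_eq_add_neg]

theorem eta_single_left (i : Fin (n + 1)) (t : ℝ) (v : Fin (n + 1) → ℝ) :
    eta n (Pi.single i t) v = eps n i * t * v i := by
  rw [eta, Finset.sum_eq_single i]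
  · simp
  · intro j _ hj
    simp [Pi.single_eq_of_ne hj]
  · simp

theorem eps_last : eps n (Fin.last n) = -1 := by simp [eps]

theorem eps_of_ne {i : Fin (n + 1)} (hi : i ≠ Fin.last n) : eps n i = 1 := by simp [eps, hi]

theorem eta_eq_sum_castSucc (u v : Fin (n + 1) → ℝ) :
    eta n u v = ∑ i : Fin n, u i.castSucc * v i.castSucc - u (Fin.last n) * v (Fin.last n) := by
  rw [eta, Fin.sum_univ_castSucc, eps_last]
  have h : ∀ i : Fin n, eps n i.castSucc = 1 := fun i => eps_of_ne (Fin.castSucc_lt_last i).ne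
  simp only [h]
  simp only [one_mul, neg_mul, sub_eq_add_neg]

theorem sq_apply_le_eta (u : Fin (n + 1) → ℝ) {i : Fin (n + 1)} (hi : i ≠ Fin.last n) :
    u i ^ 2 ≤ eta n u u + u (Fin.last n) ^ 2 := by
  obtain ⟨j, rfl⟩ := Fin.exists_castSucc_eq.2 hi
  have h := Finset.single_le_sum (f := fun k : Fin n => u k.castSucc * u k.castSucc)
    (fun k _ => mul_self_nonneg _) (Finset.mem_univ j)
  rw [eta_eq_sum_castSucc]
  linarith

theorem eq_zero_of_last_eq_zero {u : Fin (n + 1) → ℝ} (h0 : u (Fin.last n) = 0)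
    (hu : eta n u u ≤ 0) : u = 0 := by
  funext i
  by_cases hi : i = Fin.last n
  · rw [hi, h0, Pi.zero_apply]
  · have h := sq_apply_le_eta u hi
    rw [h0] at h
    exact pow_eq_zero_iff two_ne_zero |>.1 (le_antisymm (by linarith) (sq_nonneg (u i)))

theorem exists_smul_of_null {u v : Fin (n + 1) → ℝ} (hu0 : u ≠ 0) (hu : eta n u u = 0)
    (hv : eta n v v = 0) (huv : eta n u v = 0) : ∃ s : ℝ, v = s • u := by
  have hl : u (Fin.last n) ≠ 0 := fun h => hu0 (eq_zero_of_last_eq_zero h hu.le)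
  refine ⟨v (Fin.last n) / u (Fin.last n), ?_⟩
  rw [← sub_eq_zero]
  apply eq_zero_of_last_eq_zero
  · simp [hl]
  · simp only [eta_sub_left, eta_sub_right, eta_smul_left, eta_smul_right, eta_comm v u, hu, hv,
      huv]
    simp

/-- Future-directed causal vectors have nonpositive product. -/
theorem eta_nonpos_of_causal {u v : Fin (n + 1) → ℝ} (hu : eta n u u ≤ 0)
    (hul : 0 ≤ u (Fin.last n)) (hv : eta n v v ≤ 0) (hvl : 0 ≤ v (Fin.last n)) :
    eta n u v ≤ 0 := by
  by_contra! h
  have hul' : 0 < u (Fin.last n) := by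
    refine hul.lt_of_ne fun h0 => ?_
    rw [eq_zero_of_last_eq_zero h0.symm hu] at h
    simp [eta] at h
  have hvl' : 0 < v (Fin.last n) := by
    refine hvl.lt_of_ne fun h0 => ?_
    rw [eq_zero_of_last_eq_zero h0.symm hv] at h
    simp [eta] at h
  set a := u (Fin.last n)
  set b := v (Fin.last n)
  have hQ : eta n (b • u - a • v) (b • u - a • v)
      = b ^ 2 * eta n u u + a ^ 2 * eta n v v - 2 * (a * b * eta n u v) := by
    simp only [eta_sub_left, eta_sub_right, eta_smul_left, eta_smul_right, eta_comm v u]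
    ring
  have h1 : b ^ 2 * eta n u u ≤ 0 := mul_nonpos_of_nonneg_of_nonpos (sq_nonneg _) hu
  have h2 : a ^ 2 * eta n v v ≤ 0 := mul_nonpos_of_nonneg_of_nonpos (sq_nonneg _) hv
  have h3 : 0 < a * b * eta n u v := by positivity
  have hz : b • u - a • v = 0 := by
    apply eq_zero_of_last_eq_zero
    · simp only [Pi.sub_apply, Pi.smul_apply, smul_eq_mul]
      exact sub_eq_zero.2 (mul_comm _ _)
    · linarith
  rw [hz] at hQ
  simp only [eta, Pi.zero_apply, mul_zero, Finset.sum_const_zero] at hQ h1 h2 h3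
  linarith

/-- Null vectors generate the whole space as an additive group. -/
theorem addSubgroup_eq_top_of_null_mem (hn : 2 ≤ n) (P : AddSubgroup (Fin (n + 1) → ℝ))
    (hP : ∀ u, eta n u u = 0 → u ∈ P) : P = ⊤ := by
  have hnull : ∀ i : Fin (n + 1), i ≠ Fin.last n → ∀ s t : ℝ, s ^ 2 = t ^ 2 →
      Pi.single i s + Pi.single (Fin.last n) t ∈ P := by
    intro i hi s t hst
    apply hP
    simp only [eta_add_left, eta_add_right, eta_single_left, eps_last, eps_of_ne hi,
      Pi.single_eq_same, Pi.single_eq_of_ne hi, Pi.single_eq_of_ne hi.symm]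
    linear_combination hst
  have hsingle : ∀ (i : Fin (n + 1)) (t : ℝ), Pi.single i t ∈ P := by
    have key : ∀ i : Fin (n + 1), i ≠ Fin.last n → ∀ t : ℝ,
        Pi.single i t ∈ P ∧ Pi.single (Fin.last n) t ∈ P := by
      intro i hi t
      have h1 := hnull i hi (t / 2) (t / 2) rfl
      have h2 := hnull i hi (t / 2) (-(t / 2)) (by ring)
      constructor
      · convert P.add_mem h1 h2 using 1
        rw [add_add_add_comm, ← Pi.single_add, ← Pi.single_add]
        simp
      · convert P.sub_mem h1 h2 using 1
        rw [add_sub_add_comm, ← Pi.single_sub, ← Pi.single_sub]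
        simp
    intro i t
    by_cases hi : i = Fin.last n
    · subst hi
      exact (key 0 (by simp [Fin.ext_iff]; omega) t).2
    · exact (key i hi t).1
  refine (AddSubgroup.eq_top_iff' P).2 fun v => ?_
  rw [← Finset.univ_sum_single v]
  exact P.sum_mem fun i _ => hsingle i (v i)

/-- A nonzero null vector is a sum of null vectors that are not orthogonal to it. -/
theorem mem_of_nonorthogonal_null_mem (hn : 2 ≤ n) (P : AddSubgroup (Fin (n + 1) → ℝ))
    {l : Fin (n + 1) → ℝ} (hl : eta n l l = 0) (hl0 : l ≠ 0)
    (hP : ∀ u, eta n u u = 0 → eta n l u ≠ 0 → u ∈ P) : l ∈ P := by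
  have hll : l (Fin.last n) ≠ 0 := fun h => hl0 (eq_zero_of_last_eq_zero h hl.le)
  set a := l (Fin.last n) with ha
  obtain ⟨w, hw0, hwl, hlw⟩ : ∃ w : Fin (n + 1) → ℝ, w ≠ 0 ∧ w (Fin.last n) = 0 ∧
      eta n w l = 0 := by
    let i : Fin (n + 1) := ⟨0, by omega⟩
    let j : Fin (n + 1) := ⟨1, by omega⟩
    have hi : i ≠ Fin.last n := by simp [i, Fin.ext_iff]; omega
    have hj : j ≠ Fin.last n := by simp [j, Fin.ext_iff]; omega
    have hij : i ≠ j := by simp [i, j, Fin.ext_iff]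
    by_cases h : l i = 0
    · refine ⟨Pi.single i 1, by simp, Pi.single_eq_of_ne hi.symm _, ?_⟩
      simp [eta_single_left, h]
    · refine ⟨Pi.single i (l j) - Pi.single j (l i), fun h0 => h ?_, ?_, ?_⟩
      · have := congrFun h0 j
        simpa [Pi.single_eq_of_ne hij.symm] using this
      · simp [Pi.single_eq_of_ne hi.symm, Pi.single_eq_of_ne hj.symm]
      · rw [eta_sub_left, eta_single_left, eta_single_left, eps_of_ne hi, eps_of_ne hj]
        ring
  have hQ : 0 < eta n w w := by
    by_contra! h
    exact hw0 (eq_zero_of_last_eq_zero hwl h)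
  obtain ⟨c, hcl, hlc, hcc⟩ : ∃ c : Fin (n + 1) → ℝ, c (Fin.last n) = 0 ∧
      eta n l c = 0 ∧ eta n c c = a ^ 2 := by
    refine ⟨(a / √(eta n w w)) • w, by simp [hwl], ?_, ?_⟩
    · rw [eta_smul_right, eta_comm l w, hlw, mul_zero]
    · rw [eta_smul_left, eta_smul_right, ← mul_assoc, ← pow_two, div_pow, Real.sq_sqrt hQ.le]
      field_simp
  set e : Fin (n + 1) → ℝ := Pi.single (Fin.last n) a with he
  have hev : ∀ v, eta n e v = -(a * v (Fin.last n)) := fun v => by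
    rw [he, eta_single_left, eps_last]; ring
  have hee : e (Fin.last n) = a := by simp [he]
  have hsum : l = (e + c) + (e - c) - (2 • e - l) := by
    rw [two_nsmul]; abel
  rw [hsum]
  refine P.sub_mem (P.add_mem (hP _ ?_ ?_) (hP _ ?_ ?_)) (hP _ ?_ ?_)
  all_goals
    simp only [two_nsmul, eta_add_left, eta_add_right, eta_sub_left, eta_sub_right, eta_comm c e,
      eta_comm l e, hev, hee, hcl, hlc, hcc, hl, ← ha]
  · ring
  · simpa using hll
  · ring
  · simpa using hll
  · ring
  · intro h
    apply hll
    nlinarith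

end Bilinear

section NullPreserving

variable {n : ℕ} {F : (Fin (n + 1) → ℝ) → Fin (n + 1) → ℝ}

/-- Bijections preserving null separation map light lines onto light lines. -/
theorem exists_map_add_smul (hF : Function.Bijective F)
    (hN : ∀ x y, eta n (y - x) (y - x) = 0 ↔ eta n (F y - F x) (F y - F x) = 0)
    {l : Fin (n + 1) → ℝ} (hl : eta n l l = 0) (hl0 : l ≠ 0) (x : Fin (n + 1) → ℝ) :
    (∀ t : ℝ, ∃ s : ℝ, F (x + t • l) = F x + s • (F (x + l) - F x)) ∧
      ∀ s : ℝ, ∃ t : ℝ, F (x + t • l) = F x + s • (F (x + l) - F x) := by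
  have hp : eta n (F (x + l) - F x) (F (x + l) - F x) = 0 := (hN _ _).1 (by simpa using hl)
  have hp0 : F (x + l) - F x ≠ 0 := fun h => hl0 (by simpa using hF.1 (sub_eq_zero.1 h))
  constructor
  · intro t
    have h1 : eta n (F (x + t • l) - F x) (F (x + t • l) - F x) = 0 :=
      (hN _ _).1 (by simp [eta_smul_left, eta_smul_right, hl])
    have h2 : eta n (F (x + t • l) - F (x + l)) (F (x + t • l) - F (x + l)) = 0 :=
      (hN _ _).1 (by simp [eta_sub_left, eta_sub_right, eta_smul_left, eta_smul_right, hl])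
    rw [← sub_sub_sub_cancel_right _ _ (F x)] at h2
    simp only [eta_sub_left (F (x + t • l) - F x) (F (x + l) - F x),
      eta_sub_right _ (F (x + t • l) - F x) (F (x + l) - F x), h1, hp,
      eta_comm (F (x + t • l) - F x) (F (x + l) - F x)] at h2
    obtain ⟨s, hs⟩ := exists_smul_of_null hp0 hp h1 (by linarith)
    exact ⟨s, by rw [← hs]; abel⟩
  · intro s
    obtain ⟨y, hy⟩ := hF.2 (F x + s • (F (x + l) - F x))
    have h1 : eta n (y - x) (y - x) = 0 := by
      rw [hN, hy, add_sub_cancel_left, eta_smul_left, eta_smul_right, hp]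
      simp
    have h2 : eta n (y - (x + l)) (y - (x + l)) = 0 := by
      have h : F y - F (x + l) = (s - 1) • (F (x + l) - F x) := by
        rw [hy, sub_smul, one_smul]; abel
      rw [hN, h, eta_smul_left, eta_smul_right, hp]
      simp
    rw [← sub_sub] at h2
    simp only [eta_sub_left (y - x) l, eta_sub_right _ (y - x) l, h1, hl,
      eta_comm (y - x) l] at h2
    obtain ⟨t, ht⟩ := exists_smul_of_null hl0 hl h1 (by linarith)
    refine ⟨t, ?_⟩
    rw [← ht, ← hy]
    congr 1
    abel

/-- The images of two parallel light lines joined by null segments are parallel. -/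
theorem eta_map_add_sub_eq_zero (hF : Function.Bijective F)
    (hN : ∀ x y, eta n (y - x) (y - x) = 0 ↔ eta n (F y - F x) (F y - F x) = 0)
    {l m : Fin (n + 1) → ℝ} (hl : eta n l l = 0) (hm : eta n m m = 0) (hlm : eta n l m ≠ 0)
    (x : Fin (n + 1) → ℝ) :
    eta n (F (x + l) - F x) (F (x + m + l) - F (x + m)) = 0 := by
  have hl0 : l ≠ 0 := by
    rintro rfl
    simp [eta] at hlm
  by_contra hpq
  set p := F (x + l) - F x with hp
  set q := F (x + m + l) - F (x + m) with hq
  have hqq : eta n q q = 0 := (hN _ _).1 (by simpa using hl)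
  set d := F x - F (x + m) with hd
  obtain ⟨τ, hτ⟩ := (exists_map_add_smul hF hN hl hl0 x).2 (-eta n d q / eta n p q)
  obtain ⟨s, hs⟩ := (exists_map_add_smul hF hN hl hl0 (x + m)).1 τ
  obtain ⟨s', hs'⟩ := (exists_map_add_smul hF hN hl hl0 (x + m)).1 (τ + 1)
  rw [← hp] at hτ
  rw [← hq] at hs hs'
  set r := d + (-eta n d q / eta n p q) • p with hr
  have hrq : eta n r q = 0 := by
    rw [hr, eta_add_left, eta_smul_left]
    field_simp
    ring
  have h1 : eta n (F (x + τ • l) - F (x + m + τ • l)) (F (x + τ • l) - F (x + m + τ • l)) = 0 := by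
    rw [← hN]
    have : x + τ • l - (x + m + τ • l) = -m := by abel
    rw [this, eta_neg_left, eta_neg_right, hm]
    simp
  have h2 : F (x + τ • l) - F (x + m + τ • l) = r - s • q := by
    rw [hτ, hs, hr, hd]; abel
  have h3 : F (x + τ • l) - F (x + m + (τ + 1) • l) = r - s' • q := by
    rw [hτ, hs', hr, hd]; abel
  have h4 : ∀ s : ℝ, eta n (r - s • q) (r - s • q) = eta n r r := by
    intro s
    simp only [eta_sub_left, eta_sub_right, eta_smul_left, eta_smul_right, eta_comm q r, hrq, hqq]
    ring
  have h5 : eta n (F (x + τ • l) - F (x + m + (τ + 1) • l))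
      (F (x + τ • l) - F (x + m + (τ + 1) • l)) = 0 := by
    rw [h3, h4, ← h4 s, ← h2, h1]
  rw [← hN] at h5
  have : x + τ • l - (x + m + (τ + 1) • l) = -(l + m) := by
    rw [add_smul, one_smul]; abel
  rw [this, eta_neg_left, eta_neg_right] at h5
  simp only [eta_add_left, eta_add_right, hl, hm, eta_comm m l] at h5
  apply hlm
  linarith

theorem map_add_null_sub_eq_of_nonorthogonal (hF : Function.Bijective F)
    (hN : ∀ x y, eta n (y - x) (y - x) = 0 ↔ eta n (F y - F x) (F y - F x) = 0)
    {l m : Fin (n + 1) → ℝ} (hl : eta n l l = 0) (hm : eta n m m = 0) (hlm : eta n l m ≠ 0)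
    (x : Fin (n + 1) → ℝ) :
    F (x + m + l) - F (x + m) = F (x + l) - F x := by
  have hl0 : l ≠ 0 := by
    rintro rfl
    simp [eta] at hlm
  have hm0 : m ≠ 0 := by
    rintro rfl
    simp [eta] at hlm
  have hp : eta n (F (x + l) - F x) (F (x + l) - F x) = 0 := (hN _ _).1 (by simpa using hl)
  have hp0 : F (x + l) - F x ≠ 0 := fun h => hl0 (by simpa using hF.1 (sub_eq_zero.1 h))
  have hp' : eta n (F (x + m + l) - F (x + m)) (F (x + m + l) - F (x + m)) = 0 :=
    (hN _ _).1 (by simpa using hl)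
  have hr : eta n (F (x + m) - F x) (F (x + m) - F x) = 0 := (hN _ _).1 (by simpa using hm)
  have hr0 : F (x + m) - F x ≠ 0 := fun h => hm0 (by simpa using hF.1 (sub_eq_zero.1 h))
  have hr' : eta n (F (x + l + m) - F (x + l)) (F (x + l + m) - F (x + l)) = 0 :=
    (hN _ _).1 (by simpa using hm)
  obtain ⟨α, hα⟩ := exists_smul_of_null hp0 hp hp' (eta_map_add_sub_eq_zero hF hN hl hm hlm x)
  obtain ⟨β, hβ⟩ := exists_smul_of_null hr0 hr hr'
    (eta_map_add_sub_eq_zero hF hN hm hl (by rwa [eta_comm]) x)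
  have hpr : eta n (F (x + l) - F x) (F (x + m) - F x) ≠ 0 := by
    intro h
    have h1 : eta n (F (x + l) - F (x + m)) (F (x + l) - F (x + m)) = 0 := by
      rw [← sub_sub_sub_cancel_right _ _ (F x)]
      rw [eta_sub_left (F (x + l) - F x), eta_sub_right _ (F (x + l) - F x),
        eta_sub_right _ (F (x + l) - F x), eta_comm (F (x + m) - F x) (F (x + l) - F x), hp, hr, h]
      simp
    rw [← hN, add_sub_add_left_eq_sub] at h1
    simp only [eta_sub_left, eta_sub_right, hl, hm, eta_comm m l] at h1
    apply hlm
    linarith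
  have hsum : (F (x + m + l) - F (x + m)) - (F (x + l) - F x)
      = (F (x + l + m) - F (x + l)) - (F (x + m) - F x) := by
    rw [add_right_comm x m l]; abel
  rw [hα, hβ] at hsum
  have h := congrArg (fun v => eta n v (F (x + m) - F x)) hsum
  simp only [eta_sub_left (_ • (_ - _)), eta_smul_left, hr] at h
  have hα1 : (α - 1) * eta n (F (x + l) - F x) (F (x + m) - F x) = 0 := by linarith
  rcases mul_eq_zero.1 hα1 with h1 | h1
  · rw [hα, sub_eq_zero.1 h1, one_smul]
  · exact absurd h1 hpr

theorem map_add_null (hn : 2 ≤ n) (hF : Function.Bijective F)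
    (hN : ∀ x y, eta n (y - x) (y - x) = 0 ↔ eta n (F y - F x) (F y - F x) = 0)
    {l : Fin (n + 1) → ℝ} (hl : eta n l l = 0) (x : Fin (n + 1) → ℝ) :
    F (x + l) - F x = F l - F 0 := by
  by_cases hl0 : l = 0
  · simp [hl0]
  let P : AddSubgroup (Fin (n + 1) → ℝ) :=
    { carrier := {v | ∀ x, F (x + v + l) - F (x + v) = F (x + l) - F x}
      zero_mem' := by simp
      add_mem' := by
        intro u v hu hv x
        rw [← add_assoc, hv, hu]
      neg_mem' := by
        intro u hu x
        have := hu (x + -u)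
        rw [neg_add_cancel_right] at this
        exact this.symm }
  have hP : P = ⊤ := by
    have hS : ∀ u, eta n u u = 0 → eta n l u ≠ 0 → u ∈ P := fun u hu hlu x =>
      map_add_null_sub_eq_of_nonorthogonal hF hN hl hu hlu x
    refine addSubgroup_eq_top_of_null_mem hn P fun u hu => ?_
    by_cases hlu : eta n l u = 0
    · obtain ⟨s, rfl⟩ := exists_smul_of_null hl0 hl hu hlu
      by_cases hs : s = 0
      · rw [hs, zero_smul]
        exact P.zero_mem
      refine mem_of_nonorthogonal_null_mem hn P hu (smul_ne_zero hs hl0) fun v hv hlv => hS v hv ?_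
      rw [eta_smul_left] at hlv
      exact right_ne_zero_of_mul hlv
    · exact hS u hu hlu
  have hx : x ∈ P := hP ▸ AddSubgroup.mem_top x
  simpa using hx 0

theorem map_add_sub_map_zero (hn : 2 ≤ n) (hF : Function.Bijective F)
    (hN : ∀ x y, eta n (y - x) (y - x) = 0 ↔ eta n (F y - F x) (F y - F x) = 0)
    (x y : Fin (n + 1) → ℝ) : F (x + y) - F 0 = (F x - F 0) + (F y - F 0) := by
  let P : AddSubgroup (Fin (n + 1) → ℝ) :=
    { carrier := {v | ∀ x, F (x + v) - F x = F v - F 0}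
      zero_mem' := by simp
      add_mem' := by
        intro u v hu hv x
        have h1 := hv (x + u)
        have h2 := hu x
        have h3 := hv u
        rw [← add_assoc, ← sub_add_sub_cancel _ (F (x + u)), h1, h2,
          ← sub_add_sub_cancel (F (u + v)) (F u), h3]
      neg_mem' := by
        intro u hu x
        have h1 := hu (x + -u)
        have h2 := hu (-u)
        rw [neg_add_cancel_right] at h1
        rw [neg_add_cancel] at h2
        rw [← neg_sub, h1, ← h2, neg_sub] }
  have hP : P = ⊤ := addSubgroup_eq_top_of_null_mem hn P fun u hu x => map_add_null hn hF hN hu x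
  have hy : y ∈ P := hP ▸ AddSubgroup.mem_top y
  rw [← hy x]
  abel

end NullPreserving

section Causal

variable {n : ℕ}

theorem causalLe_iff_chain {x y : Fin (n + 1) → ℝ} (hn : 2 ≤ n) :
    (eta n (y - x) (y - x) = 0 ∧ x (Fin.last n) ≤ y (Fin.last n)) ↔
      causalLe n x y ∧ ∀ z w, causalLe n x z → causalLe n z y → causalLe n x w → causalLe n w y →
        causalLe n z w ∨ causalLe n w z := by
  constructor
  · rintro ⟨h0, hl⟩
    refine ⟨⟨h0.le, hl⟩, fun z w hxz hzy hxw hwy => ?_⟩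
    by_cases hxy : y - x = 0
    · have hlast : ∀ {v}, causalLe n x v → causalLe n v y → v = x := by
        intro v h1 h2
        rw [sub_eq_zero.1 hxy] at h2
        exact sub_eq_zero.1 (eq_zero_of_last_eq_zero (sub_eq_zero.2 (le_antisymm h2.2 h1.2)) h1.1)
      rw [hlast hxz hzy, hlast hxw hwy]
      left
      simp [causalLe, eta]
    have key : ∀ {v}, causalLe n x v → causalLe n v y → ∃ s : ℝ, v = x + s • (y - x) := by
      intro v h1 h2
      have h3 := eta_nonpos_of_causal h1.1 (sub_nonneg.2 h1.2) h2.1 (sub_nonneg.2 h2.2)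
      have h4 : y - x = (v - x) + (y - v) := by abel
      have h5 : eta n (y - x) (y - x) = eta n (v - x) (v - x) + eta n (y - v) (y - v)
          + 2 * eta n (v - x) (y - v) := by
        rw [h4, eta_add_left (v - x), eta_add_right _ (v - x), eta_add_right _ (v - x),
          eta_comm (y - v) (v - x)]
        ring
      have h6 := h1.1
      have h7 := h2.1
      have h8 : eta n (y - x) (v - x) = 0 := by
        rw [h4, eta_add_left (v - x), eta_comm (y - v)]
        linarith
      obtain ⟨s, hs⟩ := exists_smul_of_null hxy h0 (by linarith) h8
      exact ⟨s, by rw [← hs]; abel⟩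
    obtain ⟨s, rfl⟩ := key hxz hzy
    obtain ⟨t, rfl⟩ := key hxw hwy
    have hnull : ∀ s t : ℝ, s ≤ t → causalLe n (x + s • (y - x)) (x + t • (y - x)) := by
      intro s t hst
      have h : x + t • (y - x) - (x + s • (y - x)) = (t - s) • (y - x) := by
        rw [sub_smul]; abel
      refine ⟨by rw [h, eta_smul_left, eta_smul_right, h0]; simp, ?_⟩
      simp only [Pi.add_apply, Pi.smul_apply, Pi.sub_apply, smul_eq_mul]
      have := mul_le_mul_of_nonneg_right hst (sub_nonneg.2 hl)
      linarith
    exact (le_total s t).imp (hnull s t) (hnull t s)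
  · rintro ⟨⟨h1, h2⟩, h⟩
    refine ⟨?_, h2⟩
    by_contra hne
    have hlt : eta n (y - x) (y - x) < 0 := h1.lt_of_ne hne
    have hi : (0 : Fin (n + 1)) ≠ Fin.last n := by simp [Fin.ext_iff]; omega
    set v := y - x with hv
    obtain ⟨δ, hδ, hδv⟩ : ∃ δ : ℝ, 0 < δ ∧ eta n v v / 4 + δ * |v 0| + δ ^ 2 ≤ 0 := by
      refine ⟨min 1 (-eta n v v / (4 * (|v 0| + 1))), by
        have : 0 < -eta n v v := by linarith
        positivity, ?_⟩
      set δ := min 1 (-eta n v v / (4 * (|v 0| + 1))) with hd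
      have hpos : 0 < δ := by
        have : 0 < -eta n v v := by linarith
        positivity
      have ha : δ ≤ 1 := min_le_left _ _
      have hb : δ * (4 * (|v 0| + 1)) ≤ -eta n v v :=
        (le_div_iff₀ (by positivity)).1 (min_le_right _ _)
      nlinarith
    set s : Fin (n + 1) → ℝ := Pi.single 0 δ with hs
    have hsv : ∀ u, eta n s u = δ * u 0 := fun u => by
      rw [hs, eta_single_left, eps_of_ne hi, one_mul]
    have hs0 : s 0 = δ := by simp [hs]
    have hsl : s (Fin.last n) = 0 := by simp [hs, Pi.single_eq_of_ne hi.symm]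
    have hvl : 0 ≤ v (Fin.last n) := sub_nonneg.2 h2
    have hplus : eta n ((1 / 2 : ℝ) • v + s) ((1 / 2 : ℝ) • v + s) ≤ 0 := by
      simp only [eta_add_left, eta_add_right, eta_smul_left, eta_smul_right, eta_comm v s, hsv, hs0]
      have := mul_le_mul_of_nonneg_left (le_abs_self (v 0)) hδ.le
      linarith
    have hminus : eta n ((1 / 2 : ℝ) • v - s) ((1 / 2 : ℝ) • v - s) ≤ 0 := by
      simp only [eta_sub_left, eta_sub_right, eta_smul_left, eta_smul_right, eta_comm v s, hsv, hs0]
      have := mul_le_mul_of_nonneg_left (neg_abs_le (v 0)) hδ.le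
      linarith
    have hy : y = x + v := by rw [hv]; abel
    have hhalf : v = (1 / 2 : ℝ) • v + (1 / 2 : ℝ) • v := by rw [← add_smul]; norm_num
    have e1 : y - (x + ((1 / 2 : ℝ) • v + s)) = (1 / 2 : ℝ) • v - s := by
      rw [hy]; nth_rewrite 1 [hhalf]; abel
    have e2 : y - (x + ((1 / 2 : ℝ) • v - s)) = (1 / 2 : ℝ) • v + s := by
      rw [hy]; nth_rewrite 1 [hhalf]; abel
    have hyl : y (Fin.last n) = x (Fin.last n) + v (Fin.last n) := by rw [hy]; rfl
    have hspace : ∀ z w, w - z = (2 : ℝ) • s ∨ w - z = (-2 : ℝ) • s → ¬ causalLe n z w := by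
      rintro z w hzw ⟨hc, -⟩
      rcases hzw with hzw | hzw <;>
      · rw [hzw, eta_smul_left, eta_smul_right, hsv, hs0] at hc
        nlinarith
    rcases h (x + ((1 / 2 : ℝ) • v + s)) (x + ((1 / 2 : ℝ) • v - s))
        ⟨by rwa [add_sub_cancel_left], by
          simp only [Pi.add_apply, Pi.smul_apply, smul_eq_mul, hsl]; linarith⟩
        ⟨by rwa [e1], by
          simp only [Pi.add_apply, Pi.smul_apply, smul_eq_mul, hsl]; linarith⟩
        ⟨by rwa [add_sub_cancel_left], by
          simp only [Pi.add_apply, Pi.sub_apply, Pi.smul_apply, smul_eq_mul, hsl]; linarith⟩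
        ⟨by rwa [e2], by
          simp only [Pi.add_apply, Pi.sub_apply, Pi.smul_apply, smul_eq_mul, hsl]; linarith⟩
      with hc | hc
    · refine hspace _ _ (Or.inr ?_) hc
      rw [neg_smul, two_smul]; abel
    · refine hspace _ _ (Or.inl ?_) hc
      rw [two_smul]; abel

variable {F : (Fin (n + 1) → ℝ) → Fin (n + 1) → ℝ}

theorem IsCausalAuto.eta_map_sub_eq_zero_iff (hn : 2 ≤ n) (hF : IsCausalAuto n F)
    (x y : Fin (n + 1) → ℝ) :
    eta n (y - x) (y - x) = 0 ↔ eta n (F y - F x) (F y - F x) = 0 := by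
  have key : ∀ x y, (eta n (y - x) (y - x) = 0 ∧ x (Fin.last n) ≤ y (Fin.last n)) ↔
      (eta n (F y - F x) (F y - F x) = 0 ∧ F x (Fin.last n) ≤ F y (Fin.last n)) := by
    intro x y
    rw [causalLe_iff_chain hn, causalLe_iff_chain hn]
    refine and_congr (hF.2 x y) (Iff.trans ?_ hF.1.2.forall₂.symm)
    simp only [← hF.2]
  have hsymm : ∀ x y : Fin (n + 1) → ℝ, eta n (y - x) (y - x) = eta n (x - y) (x - y) := by
    intro x y
    rw [← neg_sub, eta_neg_left, eta_neg_right, neg_neg]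
  have split : ∀ x y : Fin (n + 1) → ℝ, eta n (y - x) (y - x) = 0 ↔
      (eta n (y - x) (y - x) = 0 ∧ x (Fin.last n) ≤ y (Fin.last n)) ∨
      (eta n (x - y) (x - y) = 0 ∧ y (Fin.last n) ≤ x (Fin.last n)) := by
    intro x y
    rw [← hsymm x y, ← and_or_left]
    exact (and_iff_left (le_total _ _)).symm
  rw [split, split (F x) (F y), key x y, key y x]

/-- Additive maps preserving the future cone are continuous. -/
theorem continuous_of_map_causal (G : (Fin (n + 1) → ℝ) →+ (Fin (n + 1) → ℝ))
    (hG : ∀ v, eta n v v ≤ 0 → 0 ≤ v (Fin.last n) →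
      eta n (G v) (G v) ≤ 0 ∧ 0 ≤ G v (Fin.last n)) : Continuous G := by
  set e : Fin (n + 1) → ℝ := Pi.single (Fin.last n) 1 with he
  have hev : ∀ v, eta n e v = -v (Fin.last n) := fun v => by
    rw [he, eta_single_left, eps_last]; ring
  have hel : e (Fin.last n) = 1 := by simp [he]
  have hcone : ∀ v, eta n v v ≤ 0 → 0 ≤ v (Fin.last n) → ∀ i, |v i| ≤ v (Fin.last n) := by
    intro v h1 h2 i
    by_cases hi : i = Fin.last n
    · rw [hi, abs_of_nonneg h2]
    · exact abs_le_of_sq_le_sq (by linarith [sq_apply_le_eta v hi]) h2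
  let U : Set (Fin (n + 1) → ℝ) := {v | eta n (e + v) (e + v) < 0 ∧ eta n (e - v) (e - v) < 0 ∧
    0 < (e + v) (Fin.last n) ∧ 0 < (e - v) (Fin.last n)}
  have hU : U ∈ nhds (0 : Fin (n + 1) → ℝ) := by
    refine IsOpen.mem_nhds ?_ ?_
    · have hcont : Continuous fun v : Fin (n + 1) → ℝ => eta n v v := by
        unfold eta
        fun_prop
      simp only [U, Set.ofPred_and]
      refine ((isOpen_lt (hcont.comp (continuous_const.add continuous_id)) continuous_const).inter
        ((isOpen_lt (hcont.comp (continuous_const.sub continuous_id)) continuous_const).inter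
        ((isOpen_lt continuous_const ?_).inter (isOpen_lt continuous_const ?_))))
      · simp only [Pi.add_apply]
        fun_prop
      · simp only [Pi.sub_apply]
        fun_prop
    · simp [U, hev, hel]
  refine AddMonoidHom.continuous_of_isBounded_nhds_zero G hU ?_
  refine (Metric.isBounded_closedBall (x := (0 : Fin (n + 1) → ℝ))
    (r := G e (Fin.last n))).subset ?_
  rintro _ ⟨v, ⟨h1, h2, h3, h4⟩, rfl⟩
  have hp := hG _ h1.le h3.le
  have hm := hG _ h2.le h4.le
  have he0 := hG e (by rw [hev, hel]; norm_num) (by rw [hel]; norm_num)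
  rw [mem_closedBall_zero_iff, pi_norm_le_iff_of_nonneg he0.2]
  intro i
  have hpi := hcone _ hp.1 hp.2 i
  have hmi := hcone _ hm.1 hm.2 i
  simp only [map_add, map_sub, Pi.add_apply, Pi.sub_apply] at hpi hmi
  rw [Real.norm_eq_abs, abs_le]
  rw [abs_le] at hpi hmi
  constructor <;> linarith

end Causal

section Linear

variable {n : ℕ}

/-- A linear map preserving null vectors is conformal for the Minkowski form. -/
theorem eta_map_single (G : (Fin (n + 1) → ℝ) →ₗ[ℝ] (Fin (n + 1) → ℝ))
    (hG : ∀ v, eta n v v = 0 → eta n (G v) (G v) = 0) (i j : Fin (n + 1)) :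
    eta n (G (Pi.single i 1)) (G (Pi.single j 1)) =
      -eta n (G (Pi.single (Fin.last n) 1)) (G (Pi.single (Fin.last n) 1)) *
        etaM n i j := by
  set e : Fin (n + 1) → (Fin (n + 1) → ℝ) := fun k => Pi.single k 1 with he
  have hee : ∀ i j, eta n (e i) (e j) = etaM n i j := by
    intro i j
    simp only [he, eta_single_left, etaM, Matrix.diagonal_apply, Pi.single_apply, mul_one]
    split_ifs <;> simp_all
  have hd : ∀ i, i ≠ Fin.last n → etaM n i i = 1 := fun i hi => by
    rw [etaM, Matrix.diagonal_apply_eq, eps_of_ne hi]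
  have hl : etaM n (Fin.last n) (Fin.last n) = -1 := by
    rw [etaM, Matrix.diagonal_apply_eq, eps_last]
  have ho : ∀ i j, i ≠ j → etaM n i j = 0 := fun i j hij => Matrix.diagonal_apply_ne _ hij
  set B : Fin (n + 1) → Fin (n + 1) → ℝ := fun i j => eta n (G (e i)) (G (e j)) with hB
  have hsymm : ∀ i j, B i j = B j i := fun i j => eta_comm _ _
  have h1 : ∀ i, i ≠ Fin.last n → ∀ s : ℝ, s ^ 2 = 1 →
      B i i + 2 * s * B i (Fin.last n) + B (Fin.last n) (Fin.last n) = 0 := by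
    intro i hi s hs
    have := hG (e i + s • e (Fin.last n)) (by
      simp only [eta_add_left, eta_add_right, eta_smul_left, eta_smul_right, hee, hd i hi, hl,
        ho _ _ hi, ho _ _ hi.symm]
      linear_combination -hs)
    simp only [map_add, map_smul, eta_add_left, eta_add_right, eta_smul_left, eta_smul_right,
      eta_comm (G (e (Fin.last n))) (G (e i))] at this
    simp only [hB]
    linear_combination this - eta n (G (e (Fin.last n))) (G (e (Fin.last n))) * hs
  have h2 : ∀ i, i ≠ Fin.last n → B i (Fin.last n) = 0 := fun i hi => by
    linarith [h1 i hi 1 (by norm_num), h1 i hi (-1) (by norm_num)]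
  have h3 : ∀ i, i ≠ Fin.last n → B i i = -B (Fin.last n) (Fin.last n) := fun i hi => by
    linarith [h1 i hi 1 (by norm_num), h1 i hi (-1) (by norm_num)]
  have h4 : ∀ i j, i ≠ Fin.last n → j ≠ Fin.last n → i ≠ j → B i j = 0 := by
    intro i j hi hj hij
    have := hG ((3 : ℝ) • e i + (4 : ℝ) • e j + (5 : ℝ) • e (Fin.last n)) (by
      simp only [eta_add_left, eta_add_right, eta_smul_left, eta_smul_right, hee, hd i hi, hd j hj,
        hl, ho _ _ hi, ho _ _ hi.symm, ho _ _ hj, ho _ _ hj.symm, ho _ _ hij, ho _ _ hij.symm]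
      norm_num)
    simp only [map_add, map_smul, eta_add_left, eta_add_right, eta_smul_left, eta_smul_right]
      at this
    have hi2 := h2 i hi
    have hj2 := h2 j hj
    have hi3 := h3 i hi
    have hj3 := h3 j hj
    have hji := hsymm j i
    have hli := hsymm (Fin.last n) i
    have hlj := hsymm (Fin.last n) j
    simp only [hB] at hi2 hj2 hi3 hj3 hji hli hlj ⊢
    linarith
  change B i j = -B (Fin.last n) (Fin.last n) * etaM n i j
  by_cases hij : i = j
  · subst hij
    by_cases hi : i = Fin.last n
    · rw [hi, hl]; ring
    · rw [h3 i hi, hd i hi, mul_one]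
  · rw [ho i j hij, mul_zero]
    by_cases hi : i = Fin.last n
    · subst hi
      rw [hsymm]
      exact h2 j (Ne.symm hij)
    · by_cases hj : j = Fin.last n
      · subst hj
        exact h2 i hi
      · exact h4 i j hi hj hij

theorem transpose_mul_etaM_mul_apply (A : Matrix (Fin (n + 1)) (Fin (n + 1)) ℝ)
    (i j : Fin (n + 1)) : (Aᵀ * etaM n * A) i j = eta n (A.col i) (A.col j) := by
  rw [Matrix.mul_apply]
  simp only [etaM, Matrix.mul_diagonal, Matrix.transpose_apply, eta, Matrix.col_apply]
  exact Finset.sum_congr rfl fun k _ => by ring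

end Linear

/-- **Zeeman's theorem.** For `n ≥ 2`, every causal automorphism of `(n+1)`-dimensional
Minkowski spacetime has the form `F(x) = a • (A x) + b` with `a > 0`, `A` an
orthochronous Lorentz matrix and `b` a translation vector. -/
theorem zeeman_causal_automorphism (n : ℕ) (hn : 2 ≤ n)
    (F : (Fin (n + 1) → ℝ) → (Fin (n + 1) → ℝ)) (hF : IsCausalAuto n F) :
    ∃ (a : ℝ) (A : Matrix (Fin (n + 1)) (Fin (n + 1)) ℝ) (b : Fin (n + 1) → ℝ),
      0 < a ∧ IsLorentz n A ∧ 1 ≤ A (Fin.last n) (Fin.last n) ∧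
      ∀ x, F x = a • A.mulVec x + b := by
  have hN := hF.eta_map_sub_eq_zero_iff hn
  let G₀ : (Fin (n + 1) → ℝ) →+ (Fin (n + 1) → ℝ) :=
    { toFun := fun x => F x - F 0
      map_zero' := sub_self _
      map_add' := map_add_sub_map_zero hn hF.1 hN }
  have hcausal : ∀ v, eta n v v ≤ 0 → 0 ≤ v (Fin.last n) →
      eta n (G₀ v) (G₀ v) ≤ 0 ∧ 0 ≤ G₀ v (Fin.last n) := by
    intro v h1 h2
    obtain ⟨h3, h4⟩ := (hF.2 0 v).1 ⟨by simpa using h1, h2⟩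
    exact ⟨h3, sub_nonneg.2 h4⟩
  let G : (Fin (n + 1) → ℝ) →ₗ[ℝ] (Fin (n + 1) → ℝ) :=
    (G₀.toRealLinearMap (continuous_of_map_causal G₀ hcausal)).toLinearMap
  have hG : ∀ x, G x = F x - F 0 := fun x => rfl
  have hGnull : ∀ v, eta n v v = 0 ↔ eta n (G v) (G v) = 0 := fun v => by
    simpa [hG] using hN 0 v
  set e : Fin (n + 1) → ℝ := Pi.single (Fin.last n) 1 with he
  have hee : eta n e e = -1 := by
    rw [he, eta_single_left, eps_last]; simp
  obtain ⟨hGe, hGel⟩ := hcausal e (by rw [hee]; norm_num) (by simp [he])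
  change eta n (G e) (G e) ≤ 0 at hGe
  change 0 ≤ G e (Fin.last n) at hGel
  have hc : 0 < -eta n (G e) (G e) := by
    have : eta n (G e) (G e) ≠ 0 := fun h => by
      rw [← hGnull, hee] at h
      norm_num at h
    have := hGe.lt_of_ne this
    linarith
  set a := √(-eta n (G e) (G e)) with ha
  have ha0 : 0 < a := Real.sqrt_pos.2 hc
  have ha2 : a * a = -eta n (G e) (G e) := Real.mul_self_sqrt hc.le
  set A : Matrix (Fin (n + 1)) (Fin (n + 1)) ℝ := a⁻¹ • LinearMap.toMatrix' G with hA
  have hcol : ∀ i, A.col i = a⁻¹ • G (Pi.single i 1) := by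
    intro i
    funext k
    simp [hA, LinearMap.toMatrix'_apply, Matrix.col_apply]
  have hLor : IsLorentz n A := by
    ext i j
    rw [transpose_mul_etaM_mul_apply, hcol, hcol, eta_smul_left, eta_smul_right,
      eta_map_single G (fun v => (hGnull v).1), ← he, ← ha2]
    field_simp
  refine ⟨a, A, F 0, ha0, hLor, ?_, fun x => ?_⟩
  · have h1 : 0 ≤ A (Fin.last n) (Fin.last n) := by
      have := congrFun (hcol (Fin.last n)) (Fin.last n)
      rw [Matrix.col_apply] at this
      rw [this]
      exact mul_nonneg (inv_nonneg.2 ha0.le) hGel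
    have h2 := transpose_mul_etaM_mul_apply A (Fin.last n) (Fin.last n)
    rw [hLor, etaM, Matrix.diagonal_apply_eq, eps_last, eta_eq_sum_castSucc] at h2
    have h3 : 0 ≤ ∑ i : Fin n, A.col (Fin.last n) i.castSucc * A.col (Fin.last n) i.castSucc :=
      Finset.sum_nonneg fun i _ => mul_self_nonneg _
    simp only [Matrix.col_apply] at h2 h3
    nlinarith
  · rw [hA, Matrix.smul_mulVec, smul_smul, mul_inv_cancel₀ ha0.ne', one_smul,
      LinearMap.toMatrix'_mulVec, hG, sub_add_cancel]
end
end

section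
/- Let n ≥ 2 and let F : ℝ^{n+1} → ℝ^{n+1} be a smooth diffeomorphism, written y = F(x) with component functions y_1, …, y_{n+1}. Assume that for every smooth function ψ : ℝ^{n+1} → ℝ, the composite ψ∘F satisfies the wave equation □(ψ∘F) = 0 on ℝ^{n+1} if and only if ψ satisfies □ψ = 0 on ℝ^{n+1}. Then at every point of ℝ^{n+1} the rows of the Jacobian matrix (∂y_i/∂x_j), i.e. the Minkowski gradients r_i = (∂y_i/∂x_1, …, ∂y_i/∂x_{n+1}), satisfy: (1) η(r_j, r_k) = 0 for all j ≠ k; (2) η(r_i, r_i) = −η(r_{n+1}, r_{n+1}) for all 1 ≤ i ≤ n (all rows have the same Minkowski length); (3) r_i is spacelike (η(r_i,r_i) > 0) for 1 ≤ i ≤ n and r_{n+1} is timelike (η(r_{n+1},r_{n+1}) < 0). -/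
open scoped BigOperators
open Matrix

noncomputable section

section WaveOperator

variable {n : ℕ} {f g : (Fin (n + 1) → ℝ) → ℝ}

lemma contDiff_pd (hf : ContDiff ℝ (⊤ : ℕ∞) f) (i : Fin (n + 1)) :
    ContDiff ℝ (⊤ : ℕ∞) (pd n f i) :=
  (hf.fderiv_right (m := (⊤ : ℕ∞)) (by simp)).clm_apply contDiff_const

lemma pd_add (hf : Differentiable ℝ f) (hg : Differentiable ℝ g) (i : Fin (n + 1)) :
    pd n (fun z => f z + g z) i = fun x => pd n f i x + pd n g i x := by
  funext x
  simp [pd, fderiv_fun_add (hf x) (hg x)]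

lemma pd_mul (hf : Differentiable ℝ f) (hg : Differentiable ℝ g) (i : Fin (n + 1)) :
    pd n (fun z => f z * g z) i = fun x => f x * pd n g i x + g x * pd n f i x := by
  funext x
  simp [pd, fderiv_fun_mul (hf x) (hg x)]

lemma waveOp_add (hf : ContDiff ℝ (⊤ : ℕ∞) f) (hg : ContDiff ℝ (⊤ : ℕ∞) g)
    (x : Fin (n + 1) → ℝ) :
    waveOp n (fun z => f z + g z) x = waveOp n f x + waveOp n g x := by
  have diff {h : (Fin (n + 1) → ℝ) → ℝ} (hh : ContDiff ℝ (⊤ : ℕ∞) h) : Differentiable ℝ h :=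
    hh.differentiable (by simp)
  simp only [waveOp, ← Finset.sum_add_distrib]
  refine Finset.sum_congr rfl fun i _ => ?_
  rw [pd_add (diff hf) (diff hg), pd_add (diff (contDiff_pd hf i)) (diff (contDiff_pd hg i))]
  ring

/-- The Leibniz rule for the wave operator. -/
lemma waveOp_mul (hf : ContDiff ℝ (⊤ : ℕ∞) f) (hg : ContDiff ℝ (⊤ : ℕ∞) g)
    (x : Fin (n + 1) → ℝ) :
    waveOp n (fun z => f z * g z) x = f x * waveOp n g x + g x * waveOp n f x +
      2 * eta n (fun i => pd n f i x) (fun i => pd n g i x) := by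
  have diff {h : (Fin (n + 1) → ℝ) → ℝ} (hh : ContDiff ℝ (⊤ : ℕ∞) h) : Differentiable ℝ h :=
    hh.differentiable (by simp)
  simp only [waveOp, eta, Finset.mul_sum, ← Finset.sum_add_distrib]
  refine Finset.sum_congr rfl fun i _ => ?_
  have hf' := contDiff_pd hf i
  have hg' := contDiff_pd hg i
  rw [pd_mul (diff hf) (diff hg), pd_add (diff (hf.mul hg')) (diff (hg.mul hf')),
    pd_mul (diff hf) (diff hg'), pd_mul (diff hg) (diff hf')]
  ring

lemma pd_coord (j i : Fin (n + 1)) :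
    pd n (fun z => z j) i = fun _ => (Pi.single i 1 : Fin (n + 1) → ℝ) j := by
  funext x
  rw [pd, (hasFDerivAt_apply j x).fderiv]
  rfl

lemma waveOp_coord (j : Fin (n + 1)) (x : Fin (n + 1) → ℝ) :
    waveOp n (fun z => z j) x = 0 := by
  simp only [waveOp, pd_coord]
  simp [pd]

lemma contDiff_coord (j : Fin (n + 1)) :
    ContDiff ℝ (⊤ : ℕ∞) (fun z : Fin (n + 1) → ℝ => z j) :=
  contDiff_apply ℝ ℝ j

lemma waveOp_coord_mul (j k : Fin (n + 1)) (x : Fin (n + 1) → ℝ) :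
    waveOp n (fun z => z j * z k) x = if j = k then 2 * eps n j else 0 := by
  rw [waveOp_mul (contDiff_coord j) (contDiff_coord k)]
  rcases eq_or_ne j k with rfl | hjk
  · simp [waveOp_coord, pd_coord, eta, Pi.single_apply]
  · simp [waveOp_coord, pd_coord, eta, Pi.single_apply, hjk]

end WaveOperator

/-- A vector with vanishing time coordinate and non-positive Minkowski square is zero. -/
lemma eq_zero_of_last_eq_zero_of_eta_nonpos {n : ℕ} {v : Fin (n + 1) → ℝ}
    (hv : v (Fin.last n) = 0) (h : eta n v v ≤ 0) : v = 0 := by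
  have hsum : eta n v v = ∑ i, v i ^ 2 := by
    refine Finset.sum_congr rfl fun i _ => ?_
    by_cases hi : i = Fin.last n
    · simp [hi, hv]
    · simp [eps, hi, sq]
  have hnonneg : ∀ i ∈ Finset.univ, 0 ≤ v i ^ 2 := fun i _ => sq_nonneg _
  rw [hsum] at h
  have h0 := (Finset.sum_eq_zero_iff_of_nonneg hnonneg).1 (le_antisymm h (Finset.sum_nonneg hnonneg))
  funext i
  simpa using h0 i (Finset.mem_univ i)

lemma eta_combination {n : ℕ} (a b : ℝ) (u v : Fin (n + 1) → ℝ) :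
    eta n (a • u + b • v) (a • u + b • v) =
      a ^ 2 * eta n u u + 2 * (a * b) * eta n u v + b ^ 2 * eta n v v := by
  simp only [eta, Finset.mul_sum, ← Finset.sum_add_distrib]
  refine Finset.sum_congr rfl fun i _ => ?_
  simp only [Pi.add_apply, Pi.smul_apply, smul_eq_mul]
  ring

/-- Two linearly independent, `η`-orthogonal vectors of equal Minkowski square are spacelike. -/
lemma eta_pos_of_linearIndependent {n : ℕ} {u v : Fin (n + 1) → ℝ}
    (hind : LinearIndependent ℝ ![u, v]) (horth : eta n u v = 0)
    (heq : eta n u u = eta n v v) : 0 < eta n u u := by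
  by_contra! h
  rw [LinearIndependent.pair_iff] at hind
  have key (a b : ℝ) (hlast : a * u (Fin.last n) + b * v (Fin.last n) = 0) : a = 0 ∧ b = 0 := by
    refine hind a b (eq_zero_of_last_eq_zero_of_eta_nonpos (by simpa using hlast) ?_)
    rw [eta_combination, horth, ← heq]
    nlinarith [mul_nonpos_of_nonneg_of_nonpos (sq_nonneg a) h,
      mul_nonpos_of_nonneg_of_nonpos (sq_nonneg b) h]
  obtain ⟨hv, -⟩ := key (v (Fin.last n)) (-u (Fin.last n)) (by ring)
  exact one_ne_zero (key 0 1 (by simp [hv])).2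

lemma sum_jacRow_mul {n : ℕ} {F : (Fin (n + 1) → ℝ) → (Fin (n + 1) → ℝ)}
    {x : Fin (n + 1) → ℝ} (hF : DifferentiableAt ℝ F x) (i : Fin (n + 1))
    (w : Fin (n + 1) → ℝ) : ∑ j, w j * jacRow n F i x j = fderiv ℝ F x w i := by
  have hpd (j : Fin (n + 1)) : jacRow n F i x j = fderiv ℝ F x (Pi.single j 1) i := by
    simp only [jacRow, pd]
    rw [((hasFDerivAt_pi'.1 hF.hasFDerivAt) i).fderiv]
    rfl
  have hw : w = ∑ j, w j • (Pi.single j 1 : Fin (n + 1) → ℝ) := by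
    simp [← Pi.single_smul, Finset.univ_sum_single]
  conv_rhs => rw [hw]
  simp [hpd]

/-- The rows of the Jacobian of a map with a differentiable right inverse are independent. -/
lemma linearIndependent_jacRow {n : ℕ} {F G : (Fin (n + 1) → ℝ) → (Fin (n + 1) → ℝ)}
    (hF : Differentiable ℝ F) (hG : Differentiable ℝ G) (hGF : Function.LeftInverse G F)
    (hFG : Function.RightInverse G F) (x : Fin (n + 1) → ℝ) :
    LinearIndependent ℝ (fun i => jacRow n F i x) := by
  have hcomp : (fderiv ℝ F x).comp (fderiv ℝ G (F x)) = ContinuousLinearMap.id ℝ _ := by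
    have h := fderiv_comp (F x) (hF (G (F x))) (hG (F x))
    rw [hGF x, hFG.comp_eq_id, fderiv_id] at h
    exact h.symm
  rw [Fintype.linearIndependent_iff]
  intro c hc i
  set w := fderiv ℝ G (F x) (Pi.single i 1)
  have hw : fderiv ℝ F x w = Pi.single i 1 := DFunLike.congr_fun hcomp (Pi.single i 1)
  calc c i = ∑ k, c k * fderiv ℝ F x w k := by simp [hw, Pi.single_apply]
    _ = ∑ j, w j * (∑ k, c k • jacRow n F k x) j := by
      simp only [← sum_jacRow_mul (hF x), Finset.sum_apply, Finset.mul_sum, Pi.smul_apply,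
        smul_eq_mul]
      rw [Finset.sum_comm]
      exact Finset.sum_congr rfl fun _ _ => Finset.sum_congr rfl fun _ _ => by ring
    _ = 0 := by rw [hc]; simp

/-- If a smooth diffeomorphism `F` of `ℝ^{n+1}` (with `n ≥ 2`) transforms solutions of the
wave equation exactly to solutions of the wave equation, then at every point the rows of its
Jacobian are mutually `η`-orthogonal, all of the same Minkowski length, the first `n` rows
being spacelike and the last row timelike. -/
theorem jacobian_rows_of_wave_preserving (n : ℕ) (hn : 2 ≤ n)
    (F G : (Fin (n + 1) → ℝ) → (Fin (n + 1) → ℝ))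
    (hF : ContDiff ℝ (⊤ : ℕ∞) F) (hG : ContDiff ℝ (⊤ : ℕ∞) G)
    (hGF : Function.LeftInverse G F) (hFG : Function.RightInverse G F)
    (hwave : ∀ ψ : (Fin (n + 1) → ℝ) → ℝ, ContDiff ℝ (⊤ : ℕ∞) ψ →
      ((∀ x, waveOp n (ψ ∘ F) x = 0) ↔ (∀ x, waveOp n ψ x = 0))) :
    ∀ x : Fin (n + 1) → ℝ,
      (∀ j k, j ≠ k → eta n (jacRow n F j x) (jacRow n F k x) = 0) ∧
      (∀ i, i ≠ Fin.last n →
        eta n (jacRow n F i x) (jacRow n F i x) =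
          - eta n (jacRow n F (Fin.last n) x) (jacRow n F (Fin.last n) x)) ∧
      (∀ i, i ≠ Fin.last n → 0 < eta n (jacRow n F i x) (jacRow n F i x)) ∧
      eta n (jacRow n F (Fin.last n) x) (jacRow n F (Fin.last n) x) < 0 := by
  intro x
  have hFi (i : Fin (n + 1)) : ContDiff ℝ (⊤ : ℕ∞) (fun z => F z i) := contDiff_pi.1 hF i
  have hbox (i : Fin (n + 1)) : waveOp n (fun z => F z i) x = 0 :=
    (hwave _ (contDiff_coord i)).2 (waveOp_coord i) x
  have hprod (j k : Fin (n + 1)) :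
      waveOp n (fun z => F z j * F z k) x = 2 * eta n (jacRow n F j x) (jacRow n F k x) := by
    rw [waveOp_mul (hFi j) (hFi k), hbox, hbox]
    simp only [mul_zero, zero_add]
    rfl
  have horth (j k : Fin (n + 1)) (hjk : j ≠ k) :
      eta n (jacRow n F j x) (jacRow n F k x) = 0 := by
    have h : waveOp n (fun z => F z j * F z k) x = 0 :=
      (hwave _ ((contDiff_coord j).mul (contDiff_coord k))).2
        (fun y => by rw [waveOp_coord_mul, if_neg hjk]) x
    linarith [hprod j k]
  have hlen (i : Fin (n + 1)) (hi : i ≠ Fin.last n) :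
      eta n (jacRow n F i x) (jacRow n F i x) =
        - eta n (jacRow n F (Fin.last n) x) (jacRow n F (Fin.last n) x) := by
    have hsq (j : Fin (n + 1)) := (contDiff_coord j).mul (contDiff_coord j)
    have h : waveOp n (fun z => F z i * F z i + F z (Fin.last n) * F z (Fin.last n)) x = 0 :=
      (hwave _ ((hsq i).add (hsq (Fin.last n)))).2
        (fun y => by
          rw [waveOp_add (hsq i) (hsq (Fin.last n)), waveOp_coord_mul, waveOp_coord_mul]
          simp [eps, hi]) x
    rw [waveOp_add ((hFi i).mul (hFi i)) ((hFi _).mul (hFi _)), hprod, hprod] at h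
    linarith
  have hind := linearIndependent_jacRow (hF.differentiable (by simp))
    (hG.differentiable (by simp)) hGF hFG x
  have hpos (i : Fin (n + 1)) (hi : i ≠ Fin.last n) :
      0 < eta n (jacRow n F i x) (jacRow n F i x) := by
    obtain ⟨k, hk⟩ : ∃ k, k ∉ ({i, Fin.last n} : Finset (Fin (n + 1))) := by
      by_contra! h
      have h1 := Finset.card_le_card (fun k _ => h k : Finset.univ ⊆ {i, Fin.last n})
      have h2 := Finset.card_le_two (a := i) (b := Fin.last n)
      simp only [Finset.card_univ, Fintype.card_fin] at h1
      omega
    simp only [Finset.mem_insert, Finset.mem_singleton, not_or] at hk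
    refine eta_pos_of_linearIndependent ?_ (horth i k (Ne.symm hk.1))
      ((hlen i hi).trans (hlen k hk.2).symm)
    convert hind.comp _ (injective_pair_iff_ne.2 (Ne.symm hk.1)) using 1
    ext a
    fin_cases a <;> rfl
  refine ⟨horth, hlen, hpos, ?_⟩
  have h0 : (0 : Fin (n + 1)) ≠ Fin.last n := by
    simp only [ne_eq, Fin.ext_iff, Fin.val_zero, Fin.val_last]
    omega
  linarith [hpos 0 h0, hlen 0 h0]
end
end
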